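/- Let ω = (φ−1, 1) and β ∈ [0,1]. If n = (n₁,n₂) ∈ ℤ², g ∈ Γ₀, and α ∈ [0,1] satisfy βω + n = g + αω, then ⟨(n₁,n₂), (φ−8, 1−2φ)⟩ = 3(α − β)(3 − φ); in particular |(φ−8)n₁ + (1−2φ)n₂| ≤ 3(3−φ). -/

import Mathlib

/-!
Statement 14: Let ω = (φ−1, 1) and β ∈ [0,1].  If n = (n₁,n₂) ∈ ℤ², g ∈ Γ₀ and α ∈ [0,1]
satisfy βω + n = g + αω, then ⟨(n₁,n₂), (φ−8, 1−2φ)⟩ = 3(α−β)(3−φ); in particular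
|(φ−8)n₁ + (1−2φ)n₂| ≤ 3(3−φ).
-/

noncomputable section

namespace JeandelRao

/-- The golden ratio. -/
def φ : ℝ := (1 + Real.sqrt 5) / 2

/-- The lattice Γ₀ generated by (φ,0) and (1,φ+3). -/
def Γ₀ : AddSubgroup (ℝ × ℝ) := AddSubgroup.closure {(φ, 0), (1, φ + 3)}

theorem φ_sq : φ ^ 2 = φ + 1 := Real.goldenRatio_sq

theorem φ_lt_two : φ < 2 := Real.goldenRatio_lt_two

theorem int_eq_zero_of_mul_φ_eq {a b : ℤ} (h : (a : ℝ) * φ = b) : a = 0 ∧ b = 0 := by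
  have ha : a = 0 := by
    by_contra ha
    exact (Real.goldenRatio_irrational.intCast_mul ha).ne_int b h
  subst ha
  refine ⟨rfl, ?_⟩
  rw [Int.cast_zero, zero_mul] at h
  exact_mod_cast h.symm

theorem exists_int_of_mem_Γ₀ {g : ℝ × ℝ} (hg : g ∈ Γ₀) :
    ∃ a b : ℤ, g.1 = a * φ + b ∧ g.2 = b * (φ + 3) := by
  obtain ⟨a, b, rfl⟩ := AddSubgroup.mem_closure_pair.1 hg
  exact ⟨a, b, by simp, by simp [mul_add]⟩

theorem slope_phi_case (β α : ℝ) (hβ : β ∈ Set.Icc (0 : ℝ) 1) (hα : α ∈ Set.Icc (0 : ℝ) 1)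
    (n : ℤ × ℤ) (g : ℝ × ℝ) (hg : g ∈ Γ₀)
    (h : β • ((φ - 1, 1) : ℝ × ℝ) + ((n.1 : ℝ), (n.2 : ℝ))
          = g + α • ((φ - 1, 1) : ℝ × ℝ)) :
    (n.1 : ℝ) * (φ - 8) + (n.2 : ℝ) * (1 - 2 * φ) = 3 * (α - β) * (3 - φ) ∧
      |(φ - 8) * (n.1 : ℝ) + (1 - 2 * φ) * (n.2 : ℝ)| ≤ 3 * (3 - φ) := by
  obtain ⟨a, b, hg₁, hg₂⟩ := exists_int_of_mem_Γ₀ hg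
  obtain ⟨hβ₀, hβ₁⟩ := hβ
  obtain ⟨hα₀, hα₁⟩ := hα
  have h₁ := congrArg Prod.fst h
  have h₂ := congrArg Prod.snd h
  simp only [Prod.fst_add, Prod.snd_add, Prod.smul_mk, smul_eq_mul, mul_one, hg₁, hg₂] at h₁ h₂
  have hsq := φ_sq
  have hlt := φ_lt_two
  have hrel : ((a + n.2 - 3 * b : ℤ) : ℝ) * φ = ((n.1 + n.2 - 3 * b : ℤ) : ℝ) := by
    push_cast
    linear_combination -h₁ + (φ - 1) * h₂ + (b : ℝ) * hsq
  have hsum : (n.1 : ℝ) + n.2 = 3 * b := by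
    exact_mod_cast sub_eq_zero.1 (int_eq_zero_of_mul_φ_eq hrel).2
  have key : (n.1 : ℝ) * (φ - 8) + (n.2 : ℝ) * (1 - 2 * φ) = 3 * (α - β) * (3 - φ) := by
    linear_combination 3 * (3 - φ) * h₂ - (3 - φ) * (φ + 3) * hsum - ((n.1 : ℝ) + n.2) * hsq
  refine ⟨key, ?_⟩
  rw [mul_comm (φ - 8), mul_comm (1 - 2 * φ), key, abs_le]
  constructor <;> nlinarith

end JeandelRao
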